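/- arXiv:2104.05420 — 3 statements merged into one kernel-verified Lean document; each statement's English description precedes it below -/
import Mathlib

section
/- Let N ≥ 1, q = 2^N, and let π be a permutation of {0,…,q−1}. The rotated odometer F_π has no periodic points (I_per = ∅) if and only if the permutation τ_N ∘ π of {0,…,q−1} is a single cycle of length 2^N. -/
open MeasureTheory Set Function
open scoped ENNReal

noncomputable section

/-- `A` is the von Neumann–Kakutani map on `[0,1)`:
`A x = x - (1 - 3·2⁻ⁿ)` for `x ∈ [1 - 2^(1-n), 1 - 2^(-n))`, `n ≥ 1`. -/
def IsVNK (A : ℝ → ℝ) : Prop :=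
  ∀ n : ℕ, 1 ≤ n →
    ∀ x ∈ Set.Ico (1 - (2:ℝ) ^ (1 - (n:ℤ))) (1 - (2:ℝ) ^ (-(n:ℤ))),
      A x = x - (1 - 3 * (2:ℝ) ^ (-(n:ℤ)))

/-- `R` is the interval exchange of the `q` intervals of length `1/q` determined by the
permutation `π`: `R x = x + (π p - p)/q` for `x ∈ [p/q, (p+1)/q)`. -/
def IsIET (q : ℕ) (π : Equiv.Perm (Fin q)) (R : ℝ → ℝ) : Prop :=
  ∀ p : Fin q,
    ∀ x ∈ Set.Ico (((p : ℕ) : ℝ) / (q : ℝ)) ((((p : ℕ) : ℝ) + 1) / (q : ℝ)),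
      R x = x + (((π p : ℕ) : ℝ) - ((p : ℕ) : ℝ)) / (q : ℝ)

/-- The set of periodic points of `F` in `[0,1)`. -/
def Iper (F : ℝ → ℝ) : Set ℝ :=
  {x ∈ Set.Ico (0:ℝ) 1 | ∃ k, 1 ≤ k ∧ F^[k] x = x}

/-- The set of non-periodic points of `F` in `[0,1)`. -/
def Inp (F : ℝ → ℝ) : Set ℝ := Set.Ico (0:ℝ) 1 \ Iper F

namespace IsVNK

variable {A : ℝ → ℝ}

lemma apply_of_lt_half (hA : IsVNK A) {x : ℝ} (h0 : 0 ≤ x) (h1 : x < 1 / 2) :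
    A x = x + 1 / 2 := by
  have h := hA 1 le_rfl x (by norm_num; constructor <;> linarith)
  rw [h]
  norm_num

lemma exists_mem_Ico {x : ℝ} (hx : x ∈ Ico (0 : ℝ) 1) : ∃ n : ℕ, 1 ≤ n ∧
    x ∈ Ico (1 - (2 : ℝ) ^ (1 - (n : ℤ))) (1 - (2 : ℝ) ^ (-(n : ℤ))) := by
  obtain ⟨n, h1, h2⟩ := exists_nat_pow_near_of_lt_one (x := 1 - x) (y := (1 / 2 : ℝ))
    (by linarith [hx.2]) (by linarith [hx.1]) (by norm_num) (by norm_num)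
  refine ⟨n + 1, by omega, ?_, ?_⟩
  · rw [show (1 - ((n + 1 : ℕ) : ℤ)) = -(n : ℤ) by push_cast; ring, zpow_neg, zpow_natCast,
      ← inv_pow, ← one_div]
    linarith
  · rw [zpow_neg, zpow_natCast, ← inv_pow, ← one_div]
    linarith

lemma apply_one_add_div_two (hA : IsVNK A) {y : ℝ} (hy : y ∈ Ico (0 : ℝ) 1) :
    A ((1 + y) / 2) = A y / 2 := by
  obtain ⟨n, hn, h⟩ := exists_mem_Ico hy
  have e1 : (2 : ℝ) ^ (1 - ((n + 1 : ℕ) : ℤ)) = 2 ^ (1 - (n : ℤ)) / 2 := by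
    rw [show (1 - ((n + 1 : ℕ) : ℤ)) = (1 - (n : ℤ)) - 1 by push_cast; ring,
      zpow_sub_one₀ two_ne_zero, div_eq_mul_inv]
  have e2 : (2 : ℝ) ^ (-((n + 1 : ℕ) : ℤ)) = 2 ^ (-(n : ℤ)) / 2 := by
    rw [show (-((n + 1 : ℕ) : ℤ)) = -(n : ℤ) - 1 by push_cast; ring,
      zpow_sub_one₀ two_ne_zero, div_eq_mul_inv]
  rw [hA n hn y h, hA (n + 1) (by omega) ((1 + y) / 2), e2]
  · ring
  · rw [e1, e2]
    constructor <;> linarith [h.1, h.2]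

lemma mapsTo (hA : IsVNK A) : MapsTo A (Ico (0 : ℝ) 1) (Ico (0 : ℝ) 1) := by
  intro x hx
  obtain ⟨n, hn, h⟩ := exists_mem_Ico hx
  rw [hA n hn x h]
  have e : (2 : ℝ) ^ (1 - (n : ℤ)) = 2 * 2 ^ (-(n : ℤ)) := by
    rw [sub_eq_add_neg, zpow_add₀ two_ne_zero, zpow_one]
  have hle : (2 : ℝ) ^ (1 - (n : ℤ)) ≤ 1 :=
    zpow_le_one_of_nonpos₀ one_le_two (by omega)
  have hpos : (0 : ℝ) < 2 ^ (-(n : ℤ)) := by positivity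
  have h1 := h.1
  have h2 := h.2
  rw [e] at h1 hle
  constructor <;> linarith

lemma apply_apply_div_two (hA : IsVNK A) {y : ℝ} (hy : y ∈ Ico (0 : ℝ) 1) :
    A (A (y / 2)) = A y / 2 := by
  rw [hA.apply_of_lt_half (x := y / 2) (by linarith [hy.1]) (by linarith [hy.2]),
    ← hA.apply_one_add_div_two hy]
  congr 1
  ring

lemma iterate_two_mul_div_two (hA : IsVNK A) (j : ℕ) {y : ℝ} (hy : y ∈ Ico (0 : ℝ) 1) :
    A^[2 * j] (y / 2) = A^[j] y / 2 := by
  induction j generalizing y with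
  | zero => simp
  | succ j ih =>
    rw [show 2 * (j + 1) = 2 * j + 1 + 1 by ring, iterate_succ_apply, iterate_succ_apply,
      iterate_succ_apply, hA.apply_apply_div_two hy, ih (hA.mapsTo hy)]

/-- The von Neumann–Kakutani map has no periodic points: it interchanges the two halves of
`[0,1)` and its square is conjugate to itself on `[0,1/2)`, so periods can be halved. -/
lemma iterate_ne (hA : IsVNK A) {k : ℕ} (hk : 1 ≤ k) {x : ℝ} (hx : x ∈ Ico (0 : ℝ) 1) :
    A^[k] x ≠ x := by
  induction k using Nat.strong_induction_on generalizing x with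
  | _ k ih =>
  have key : ∀ y ∈ Ico (0 : ℝ) 1, A^[k] (y / 2) ≠ y / 2 := by
    intro y hy hper
    obtain ⟨j, rfl | rfl⟩ := Nat.even_or_odd' k
    · rw [hA.iterate_two_mul_div_two j hy] at hper
      exact ih j (by omega) (by omega) hy (by linarith)
    · have hmem : A^[j] y ∈ Ico (0 : ℝ) 1 := hA.mapsTo.iterate j hy
      rw [iterate_succ_apply', hA.iterate_two_mul_div_two j hy,
        hA.apply_of_lt_half (by linarith [hmem.1]) (by linarith [hmem.2])] at hper
      linarith [hmem.1, hy.2]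
  intro hper
  rcases lt_or_ge x (1 / 2) with h | h
  · refine key (2 * x) ⟨by linarith [hx.1], by linarith⟩ ?_
    rwa [mul_div_cancel_left₀ x two_ne_zero]
  · have hy : 2 * x - 1 ∈ Ico (0 : ℝ) 1 := ⟨by linarith, by linarith [hx.2]⟩
    have hAx : A x = A (2 * x - 1) / 2 := by
      rw [← hA.apply_one_add_div_two hy]
      congr 1
      ring
    refine key (A (2 * x - 1)) (hA.mapsTo hy) ?_
    rw [← hAx, ← iterate_succ_apply, iterate_succ_apply', hper]

lemma add_div_mem_Ico {q p : ℕ} (hp : p < q) {y : ℝ} (hy : y ∈ Ico (0 : ℝ) 1) :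
    (p + y) / q ∈ Ico (0 : ℝ) 1 := by
  have hq : (0 : ℝ) < q := by exact_mod_cast (by omega : 0 < q)
  have hp' : (p : ℝ) + 1 ≤ q := by exact_mod_cast hp
  have := hy.1
  refine ⟨by positivity, ?_⟩
  rw [div_lt_one hq]
  linarith [hy.2]

lemma apply_last (hA : IsVNK A) (N : ℕ) {y : ℝ} (hy : y ∈ Ico (0 : ℝ) 1) :
    A ((((2 ^ N - 1 : ℕ) : ℝ) + y) / 2 ^ N) = A y / 2 ^ N := by
  induction N with
  | zero => simp
  | succ N ih =>
    have hmem := add_div_mem_Ico (Nat.sub_lt (Nat.two_pow_pos N) one_pos) hy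
    have hsub : ∀ M : ℕ, ((2 ^ M - 1 : ℕ) : ℝ) = 2 ^ M - 1 := fun M => by
      rw [Nat.cast_sub Nat.one_le_two_pow]
      push_cast
      ring
    push_cast at hmem
    have e : (((2 ^ (N + 1) - 1 : ℕ) : ℝ) + y) / 2 ^ (N + 1) =
        (1 + (((2 ^ N - 1 : ℕ) : ℝ) + y) / 2 ^ N) / 2 := by
      rw [hsub, hsub]
      field_simp
      ring
    rw [e, hA.apply_one_add_div_two hmem, ih]
    field_simp
    ring

lemma exists_apply_eq (hA : IsVNK A) (N p : ℕ) (hp : p + 1 < 2 ^ N) :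
    ∃ m : ℕ, ∀ y ∈ Ico (0 : ℝ) 1, A ((p + y) / 2 ^ N) = (m + y) / 2 ^ N := by
  induction N generalizing p with
  | zero => simp at hp
  | succ N ih =>
    rcases lt_or_ge p (2 ^ N) with h | h
    · refine ⟨p + 2 ^ N, fun y hy => ?_⟩
      have hmem := add_div_mem_Ico h hy
      push_cast at hmem
      have e : (p + y) / 2 ^ (N + 1) = (p + y) / 2 ^ N / 2 := by
        field_simp
        ring
      rw [e, hA.apply_of_lt_half (by linarith [hmem.1]) (by linarith [hmem.2])]
      push_cast
      field_simp
      ring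
    · obtain ⟨r, rfl⟩ := Nat.exists_eq_add_of_le h
      obtain ⟨m, hm⟩ := ih r (by rw [pow_succ] at hp; omega)
      refine ⟨m, fun y hy => ?_⟩
      have hmem := add_div_mem_Ico (q := 2 ^ N) (p := r) (by rw [pow_succ] at hp; omega) hy
      push_cast at hmem
      have e : (((2 ^ N + r : ℕ) : ℝ) + y) / 2 ^ (N + 1) = (1 + (r + y) / 2 ^ N) / 2 := by
        push_cast
        field_simp
        ring
      rw [e, hA.apply_one_add_div_two hmem, hm y hy]
      field_simp
      ring

end IsVNK

lemma mem_dyadic_Ico_iff {N p : ℕ} {y : ℝ} :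
    (p + y) / 2 ^ N ∈ Ico ((p : ℝ) / 2 ^ N) (((p : ℝ) + 1) / 2 ^ N) ↔ y ∈ Ico (0 : ℝ) 1 := by
  have h : (0 : ℝ) < 2 ^ N := by positivity
  simp only [mem_Ico, div_le_div_iff_of_pos_right h, div_lt_div_iff_of_pos_right h]
  constructor <;> rintro ⟨_, _⟩ <;> constructor <;> linarith

lemma exists_eq_add_div_two_pow (N : ℕ) {x : ℝ} (hx : x ∈ Ico (0 : ℝ) 1) :
    ∃ p : Fin (2 ^ N), ∃ y ∈ Ico (0 : ℝ) 1, x = ((p : ℕ) + y) / 2 ^ N := by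
  have h : (0 : ℝ) < 2 ^ N := by positivity
  have h0 : 0 ≤ x * 2 ^ N := mul_nonneg hx.1 h.le
  refine ⟨⟨⌊x * 2 ^ N⌋₊, ?_⟩, x * 2 ^ N - ⌊x * 2 ^ N⌋₊, ⟨?_, ?_⟩, ?_⟩
  · rw [Nat.floor_lt h0]
    push_cast
    nlinarith [hx.2]
  · linarith [Nat.floor_le h0]
  · linarith [Nat.lt_floor_add_one (x * 2 ^ N)]
  · field_simp
    ring

lemma natCast_add_inj {a b : ℕ} {y z : ℝ} (hy : y ∈ Ico (0 : ℝ) 1) (hz : z ∈ Ico (0 : ℝ) 1)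
    (h : (a : ℝ) + y = b + z) : a = b ∧ y = z := by
  have hab : a = b := by
    have h1 : (a : ℝ) < b + 1 := by linarith [hy.1, hz.2]
    have h2 : (b : ℝ) < a + 1 := by linarith [hz.1, hy.2]
    have h3 : a < b + 1 := by exact_mod_cast h1
    have h4 : b < a + 1 := by exact_mod_cast h2
    omega
  subst hab
  exact ⟨rfl, by linarith⟩

/-- In the coordinates `x = (p + y) / 2 ^ N`, the map `A` acts on `p` as `τ` and fixes `y`, except
on the last interval, where it acts on `y` as `A`. -/
lemma IsVNK.apply_add_div {A : ℝ → ℝ} (hA : IsVNK A) {N : ℕ} {τ : Equiv.Perm (Fin (2 ^ N))}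
    (hτ : ∀ p : Fin (2^N),
      Set.MapsTo A
        (Set.Ico (((p : ℕ) : ℝ) / 2^N) ((((p : ℕ) : ℝ) + 1) / 2^N))
        (Set.Ico (((τ p : ℕ) : ℝ) / 2^N) ((((τ p : ℕ) : ℝ) + 1) / 2^N)))
    (p : Fin (2 ^ N)) {y : ℝ} (hy : y ∈ Ico (0 : ℝ) 1) :
    A (((p : ℕ) + y) / 2 ^ N) =
      ((τ p : ℕ) + if (p : ℕ) + 1 = 2 ^ N then A y else y) / 2 ^ N := by
  have hpos : (0 : ℝ) < 2 ^ N := by positivity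
  obtain ⟨m, z, hz, hmz⟩ : ∃ m : ℕ, ∃ z ∈ Ico (0 : ℝ) 1,
      A (((p : ℕ) + y) / 2 ^ N) = (m + z) / 2 ^ N ∧
        z = if (p : ℕ) + 1 = 2 ^ N then A y else y := by
    split_ifs with h
    · refine ⟨0, A y, hA.mapsTo hy, ?_, rfl⟩
      rw [show (p : ℕ) = 2 ^ N - 1 by omega, hA.apply_last N hy]
      simp
    · obtain ⟨m, hm⟩ := hA.exists_apply_eq N p (by omega)
      exact ⟨m, y, hy, hm y hy, rfl⟩
  have hmem := hτ p (mem_dyadic_Ico_iff.2 hy)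
  rw [hmz.1, mem_Ico, div_le_div_iff_of_pos_right hpos, div_lt_div_iff_of_pos_right hpos] at hmem
  have hm : m = (τ p : ℕ) := (natCast_add_inj (z := m + z - (τ p : ℕ)) hz
    ⟨by linarith [hmem.1], by linarith [hmem.2]⟩ (by ring)).1
  rw [hmz.1, ← hmz.2, hm]

lemma rotatedOdometer_apply {N : ℕ} {π : Equiv.Perm (Fin (2^N))}
    {A R F : ℝ → ℝ} (hA : IsVNK A) (hR : IsIET (2^N) π R) (hF : ∀ x, F x = A (R x))
    {τ : Equiv.Perm (Fin (2^N))}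
    (hτ : ∀ p : Fin (2^N),
      Set.MapsTo A
        (Set.Ico (((p : ℕ) : ℝ) / 2^N) ((((p : ℕ) : ℝ) + 1) / 2^N))
        (Set.Ico (((τ p : ℕ) : ℝ) / 2^N) ((((τ p : ℕ) : ℝ) + 1) / 2^N)))
    (p : Fin (2 ^ N)) {y : ℝ} (hy : y ∈ Ico (0 : ℝ) 1) :
    F (((p : ℕ) + y) / 2 ^ N) =
      ((π.trans τ p : ℕ) + if (π p : ℕ) + 1 = 2 ^ N then A y else y) / 2 ^ N := by
  have h := hR p (((p : ℕ) + y) / 2 ^ N) (by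
    push_cast
    exact mem_dyadic_Ico_iff.2 hy)
  push_cast at h
  rw [hF, h, ← add_div, show ((p : ℕ) : ℝ) + y + ((π p : ℕ) - (p : ℕ)) = (π p : ℕ) + y by ring,
    hA.apply_add_div hτ _ hy, Equiv.trans_apply]

/-- A skew product over `σ` whose fibre maps are `A` over `p₀` and the identity elsewhere. -/
lemma exists_iterate_skewProduct {ι : Type*} {A : ℝ → ℝ} {s : Set ℝ} (hA : MapsTo A s s)
    {F : ℝ → ℝ} {e : ι → ℝ → ℝ} {σ : ι → ι} {p₀ : ι}
    (hlast : ∀ y ∈ s, F (e p₀ y) = e (σ p₀) (A y))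
    (hne : ∀ p ≠ p₀, ∀ y ∈ s, F (e p y) = e (σ p) y)
    (k : ℕ) (p : ι) {y : ℝ} (hy : y ∈ s) :
    ∃ c : ℕ, F^[k] (e p y) = e (σ^[k] p) (A^[c] y) ∧ (c = 0 ↔ ∀ j < k, σ^[j] p ≠ p₀) := by
  induction k with
  | zero => exact ⟨0, by simp⟩
  | succ k ih =>
    obtain ⟨c, hc, hc0⟩ := ih
    have hmem := hA.iterate c hy
    by_cases h : σ^[k] p = p₀
    · refine ⟨c + 1, ?_, ?_⟩
      · rw [iterate_succ_apply', hc, h, hlast _ hmem, iterate_succ_apply', iterate_succ_apply', h]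
      · simp only [Nat.add_eq_zero_iff, one_ne_zero, and_false, false_iff]
        exact fun H => H k (by omega) h
    · refine ⟨c, ?_, ?_⟩
      · rw [iterate_succ_apply', hc, hne _ h _ hmem, iterate_succ_apply']
      · rw [hc0, Nat.forall_lt_succ_right]
        exact (and_iff_left h).symm

lemma Equiv.Perm.exists_pos_iterate_eq_id {ι : Type*} [Finite ι] (σ : Equiv.Perm ι) :
    ∃ n : ℕ, 1 ≤ n ∧ (⇑σ)^[n] = id :=
  ⟨orderOf σ, orderOf_pos σ, by rw [← Equiv.Perm.coe_pow, pow_orderOf_eq_one]; rfl⟩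

/-- for `q = 2^N`, the rotated odometer `F_π = ā ∘ R_π` has no periodic
points iff the permutation `τ_N ∘ π` of `{0,…,2^N-1}` is a single cycle of length `2^N`
(equivalently, the cyclic group it generates acts transitively). -/
theorem stmt12 (N : ℕ) (hN : 1 ≤ N) (π : Equiv.Perm (Fin (2^N)))
    (A R F : ℝ → ℝ) (hA : IsVNK A) (hR : IsIET (2^N) π R) (hF : ∀ x, F x = A (R x))
    (τ : Equiv.Perm (Fin (2^N)))
    (hτ : ∀ p : Fin (2^N),
      Set.MapsTo A
        (Set.Ico (((p : ℕ) : ℝ) / 2^N) ((((p : ℕ) : ℝ) + 1) / 2^N))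
        (Set.Ico (((τ p : ℕ) : ℝ) / 2^N) ((((τ p : ℕ) : ℝ) + 1) / 2^N))) :
    Iper F = ∅ ↔ ∀ p q : Fin (2^N), ∃ k : ℕ, (⇑(π.trans τ))^[k] p = q := by
  set σ := π.trans τ with hσ
  have hlast : 2 ^ N - 1 < 2 ^ N := Nat.sub_lt (Nat.two_pow_pos N) one_pos
  set p₀ : Fin (2 ^ N) := π.symm ⟨2 ^ N - 1, hlast⟩ with hp₀
  have hiff : ∀ p, (π p : ℕ) + 1 = 2 ^ N ↔ p = p₀ := fun p => by
    rw [hp₀, Equiv.eq_symm_apply, Fin.ext_iff]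
    simp only
    omega
  have hskew := fun k p {y : ℝ} => exists_iterate_skewProduct hA.mapsTo (F := F)
    (e := fun (p : Fin (2 ^ N)) y => ((p : ℕ) + y) / 2 ^ N) (σ := σ) (p₀ := p₀)
    (fun y hy => by
      simp only [rotatedOdometer_apply hA hR hF hτ p₀ hy, if_pos ((hiff p₀).2 rfl), hσ])
    (fun p hp y hy => by
      simp only [rotatedOdometer_apply hA hR hF hτ p hy, if_neg (mt (hiff p).1 hp), hσ]) k p
    (y := y)
  obtain ⟨n, hn, hid⟩ := Equiv.Perm.exists_pos_iterate_eq_id σ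
  constructor
  · intro hempty
    have hhit : ∀ p, ∃ j < n, (⇑σ)^[j] p = p₀ := by
      intro p
      by_contra! hp
      obtain ⟨c, hc, hc0⟩ := hskew n p (y := 0) (by simp)
      obtain rfl := hc0.2 hp
      rw [hid] at hc
      have hmem : ((p : ℕ) + (0 : ℝ)) / 2 ^ N ∈ Iper F :=
        ⟨by simpa using IsVNK.add_div_mem_Ico p.2 (y := 0) (by simp), n, hn, hc⟩
      simp [hempty] at hmem
    intro p r
    obtain ⟨i, -, hi⟩ := hhit p
    obtain ⟨j, hj, hjr⟩ := hhit r
    refine ⟨(n - j) + i, ?_⟩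
    rw [iterate_add_apply, hi, ← hjr, ← iterate_add_apply, Nat.sub_add_cancel hj.le, hid, id]
  · intro htrans
    rw [eq_empty_iff_forall_notMem]
    rintro x ⟨hx, k, hk, hper⟩
    obtain ⟨p, y, hy, rfl⟩ := exists_eq_add_div_two_pow N hx
    obtain ⟨c, hc, hc0⟩ := hskew k p hy
    rw [hper, div_left_inj' (by positivity)] at hc
    obtain ⟨hp, hyc⟩ := natCast_add_inj hy (hA.mapsTo.iterate c hy) hc
    have hp : (⇑σ)^[k] p = p := (Fin.ext hp).symm
    refine hA.iterate_ne (Nat.one_le_iff_ne_zero.2 fun h => ?_) hy hyc.symm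
    obtain ⟨i, hi⟩ := htrans p p₀
    refine hc0.1 h (i % k) (Nat.mod_lt _ hk) ?_
    rw [IsPeriodicPt.iterate_mod_apply hp, hi]
end
end

section
/- Let N = 2 and define h : X_2 → X_2 by h(p,w) = (c(p), w), where c is the permutation of {0,1,2,3} with c(0)=1, c(1)=2, c(2)=0, c(3)=3. Then h is a homeomorphism of X_2 induced by an automorphism of the grafted binary tree T_2, but κ_∞^{−1} ∘ h ∘ κ_∞ is not prefix-preserving: for every v ∈ {0,1}^ℕ, the sequences 10v and 11v agree in the first coordinate, while their images (κ_∞^{−1} ∘ h ∘ κ_∞)(10v) = 00v and (κ_∞^{−1} ∘ h ∘ κ_∞)(11v) = 11v differ in the first coordinate. -/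
open MeasureTheory Set Function
open scoped ENNReal

noncomputable section

/-- `f` is prefix-preserving (induced by an automorphism of the rooted binary tree):
if `v, w` agree in their first `n` coordinates, then so do `f v, f w`. -/
def PrefixPreserving (f : (ℕ → Bool) → (ℕ → Bool)) : Prop :=
  ∀ (n : ℕ) (v w : ℕ → Bool), (∀ i < n, v i = w i) → ∀ i < n, f v i = f w i

/-- `G` is induced by an automorphism of the grafted binary tree `T_N`: whenever two points
of `X_N` have the same first coordinate and their tails agree in the first `n` coordinates,
so do their images. -/
def InducedByTreeAut (N : ℕ)
    (G : Fin (2^N) × (ℕ → Bool) → Fin (2^N) × (ℕ → Bool)) : Prop :=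
  ∀ (n : ℕ) (x y : Fin (2^N) × (ℕ → Bool)),
    x.1 = y.1 → (∀ i < n, x.2 i = y.2 i) →
      (G x).1 = (G y).1 ∧ ∀ i < n, (G x).2 i = (G y).2 i

/-- The map `κ_∞ : {0,1}^ℕ → X_N`,
`κ_∞(w) = (∑_{i=1}^N 2^(N-i) w_i, w_(N+1) w_(N+2) ⋯)` (with 0-based indexing; the `%` in
the first coordinate is only there to produce an element of `Fin (2^N)`, as the sum is
already `< 2^N`). -/
def kappaInf (N : ℕ) (w : ℕ → Bool) : Fin (2^N) × (ℕ → Bool) :=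
  (⟨(∑ j ∈ Finset.range N, 2 ^ (N - 1 - j) * (w j).toNat) % 2^N,
      Nat.mod_lt _ (Nat.two_pow_pos N)⟩,
   fun j => w (N + j))

/-- Prepending two symbols `b, c` to a sequence `v ∈ {0,1}^ℕ`. -/
def cons2 (b c : Bool) (v : ℕ → Bool) : ℕ → Bool :=
  fun i => if i = 0 then b else if i = 1 then c else v (i - 2)

/-- The pair of binary digits `b c`, read as an element of `{0,1,2,3}`. -/
def digits2 (b c : Bool) : Fin (2^2) :=
  ⟨(2 * b.toNat + c.toNat) % 2^2, Nat.mod_lt _ (Nat.two_pow_pos 2)⟩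

theorem kappaInf_two (w : ℕ → Bool) :
    kappaInf 2 w = (digits2 (w 0) (w 1), fun j => w (2 + j)) := by
  simp [kappaInf, digits2, Finset.sum_range_succ]

theorem kappaInf_two_cons2 (b c : Bool) (v : ℕ → Bool) :
    kappaInf 2 (cons2 b c v) = (digits2 b c, v) := by
  rw [kappaInf_two]
  refine Prod.ext rfl (funext fun j => ?_)
  simp [cons2, show 2 + j ≠ 1 by lia]

theorem cons2_tail (w : ℕ → Bool) : cons2 (w 0) (w 1) (fun j => w (2 + j)) = w := by
  funext i
  match i with
  | 0 => rfl
  | 1 => rfl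
  | i + 2 => simp [cons2, Nat.add_comm]

theorem digits2_surj (p : Fin (2^2)) :
    digits2 (decide (2 ≤ p.val)) (decide (p.val % 2 = 1)) = p := by
  revert p
  decide

theorem high_digits2 (b c : Bool) : decide (2 ≤ (digits2 b c).val) = b := by
  revert b c
  decide

theorem low_digits2 (b c : Bool) : decide ((digits2 b c).val % 2 = 1) = c := by
  revert b c
  decide

theorem continuous_kappaInf_two : Continuous (kappaInf 2) := by
  have hd : Continuous fun q : Bool × Bool => digits2 q.1 q.2 := continuous_of_discreteTopology
  have hw : Continuous fun w : ℕ → Bool => (w 0, w 1) := by fun_prop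
  have ht : Continuous fun (w : ℕ → Bool) (j : ℕ) => w (2 + j) := by fun_prop
  exact ((hd.comp hw).prodMk ht).congr fun w => (kappaInf_two w).symm

/-- `κ_∞` for `N = 2`, as a homeomorphism. -/
def kappaInfTwoHomeomorph : (ℕ → Bool) ≃ₜ Fin (2^2) × (ℕ → Bool) where
  toFun := kappaInf 2
  invFun x := cons2 (decide (2 ≤ x.1.val)) (decide (x.1.val % 2 = 1)) x.2
  left_inv w := by
    rw [kappaInf_two]
    simp only [high_digits2, low_digits2, cons2_tail]
  right_inv x := by rw [kappaInf_two_cons2, digits2_surj]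
  continuous_toFun := continuous_kappaInf_two
  continuous_invFun := by
    have hd (f : Fin (2^2) → Bool) : Continuous f := continuous_of_discreteTopology
    refine continuous_pi fun i => ?_
    unfold cons2
    split_ifs
    · exact (hd fun p => decide (2 ≤ p.val)).comp continuous_fst
    · exact (hd fun p => decide (p.val % 2 = 1)).comp continuous_fst
    · exact (continuous_apply (i - 2)).comp continuous_snd

/-- for `N = 2` and the permutation `c = (0 1 2)(3)` of `{0,1,2,3}`, the
map `h(p,w) = (c p, w)` is a homeomorphism of `X_2` induced by an automorphism of the
grafted binary tree `T_2`, but its conjugate `κ_∞⁻¹ ∘ h ∘ κ_∞` is not prefix-preserving: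
for every `v`, the sequences `10v` and `11v` agree in the first coordinate, while their
images `00v` and `11v` differ in the first coordinate. -/
theorem stmt16 (c : Equiv.Perm (Fin (2^2)))
    (hc : c 0 = 1 ∧ c 1 = 2 ∧ c 2 = 0 ∧ c 3 = 3)
    (h : Fin (2^2) × (ℕ → Bool) → Fin (2^2) × (ℕ → Bool))
    (hh : ∀ x, h x = (c x.1, x.2)) :
    ∃ (H : (Fin (2^2) × (ℕ → Bool)) ≃ₜ (Fin (2^2) × (ℕ → Bool)))
      (K : (ℕ → Bool) ≃ₜ (Fin (2^2) × (ℕ → Bool))),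
      ⇑H = h ∧ ⇑K = kappaInf 2 ∧
      InducedByTreeAut 2 h ∧
      (∀ v : ℕ → Bool, cons2 true false v 0 = cons2 true true v 0) ∧
      (∀ v : ℕ → Bool,
        (⇑K.symm ∘ h ∘ ⇑K) (cons2 true false v) = cons2 false false v ∧
        (⇑K.symm ∘ h ∘ ⇑K) (cons2 true true v) = cons2 true true v ∧
        (⇑K.symm ∘ h ∘ ⇑K) (cons2 true false v) 0
          ≠ (⇑K.symm ∘ h ∘ ⇑K) (cons2 true true v) 0) ∧
      ¬ PrefixPreserving (⇑K.symm ∘ h ∘ ⇑K) := by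
  obtain ⟨-, -, h2, h3⟩ := hc
  have hconj (a b a' b' : Bool) (hab : c (digits2 a b) = digits2 a' b') (v : ℕ → Bool) :
      (⇑kappaInfTwoHomeomorph.symm ∘ h ∘ ⇑kappaInfTwoHomeomorph) (cons2 a b v)
        = cons2 a' b' v := by
    change kappaInfTwoHomeomorph.symm (h (kappaInf 2 (cons2 a b v))) = _
    rw [Homeomorph.symm_apply_eq, hh, kappaInf_two_cons2, hab]
    exact (kappaInf_two_cons2 a' b' v).symm
  have h10 := hconj true false false false h2
  have h11 := hconj true true true true h3
  have hne (v : ℕ → Bool) :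
      (⇑kappaInfTwoHomeomorph.symm ∘ h ∘ ⇑kappaInfTwoHomeomorph) (cons2 true false v) 0
        ≠ (⇑kappaInfTwoHomeomorph.symm ∘ h ∘ ⇑kappaInfTwoHomeomorph) (cons2 true true v) 0 := by
    rw [h10, h11]
    simp [cons2]
  refine ⟨(Equiv.toHomeomorphOfDiscrete c).prodCongr (Homeomorph.refl _), kappaInfTwoHomeomorph,
    funext fun x => (hh x).symm, rfl, ?_, fun _ => rfl, fun v => ⟨h10 v, h11 v, hne v⟩, ?_⟩
  · intro n x y hxy htail
    rw [hh, hh, hxy]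
    exact ⟨rfl, htail⟩
  · intro hpres
    refine hne (fun _ => false) (hpres 1 _ _ (fun i hi => ?_) 0 one_pos)
    obtain rfl : i = 0 := by lia
    rfl
end
end

section
/- Define maps a₁ and a₂ of {0,1}^ℕ as follows: a₁ flips the first coordinate, a₁(w)₁ = 1 − w₁ and a₁(w)_i = w_i for i ≥ 2; a₂ fixes 1^∞, and if w = 1^k 0 v₁ v₂ ⋯ with k ≥ 0 then a₂(w) = 1^k 0 (1−v₁) v₂ ⋯ (a₂ flips the coordinate immediately following the first occurrence of 0). Let h = a₁ ∘ a₂. Then: (a) for every n ≥ 1, h induces a permutation of the set of length-n prefixes which is a single cycle of length 2^n (so h has infinite order and every ⟨h⟩-orbit in {0,1}^ℕ is dense); and (b) (h ∘ a₁)² is the identity map of {0,1}^ℕ. -/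
open MeasureTheory Set Function
open scoped ENNReal

noncomputable section

/-- The dyadic adding machine on `{0,1}^ℕ`: addition of 1 with carry to the right
(coordinate `n` is flipped iff all earlier coordinates equal `1`). -/
def addingMachine (w : ℕ → Bool) : ℕ → Bool :=
  fun n => if ∀ i < n, w i = true then !(w n) else w n

/-- `a₁` flips the first coordinate. -/
def a1 : (ℕ → Bool) → (ℕ → Bool) :=
  fun w i => if i = 0 then !(w 0) else w i

/-- `a₂` flips the coordinate immediately following the first occurrence of `0`
(and fixes `1^∞`). -/
def a2 : (ℕ → Bool) → (ℕ → Bool) :=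
  fun w i =>
    if 0 < i ∧ w (i - 1) = false ∧ ∀ j < i - 1, w j = true then !(w i) else w i

/-- `G` is the permutation of `{0,1}^n` induced by `g` on length-`n` prefixes. -/
def InducesPerm (g : (ℕ → Bool) → (ℕ → Bool)) (n : ℕ)
    (G : Equiv.Perm (Fin n → Bool)) : Prop :=
  ∀ w : ℕ → Bool, ∀ i : Fin n, g w (i : ℕ) = G (fun j => w (j : ℕ)) i

/-- The sequence `b v₁ v₂ ⋯`. -/
def consSeq (b : Bool) (v : ℕ → Bool) : ℕ → Bool
  | 0 => b
  | n + 1 => v n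

theorem consSeq_zero (b : Bool) (v : ℕ → Bool) : consSeq b v 0 = b := rfl

theorem consSeq_succ (b : Bool) (v : ℕ → Bool) (n : ℕ) : consSeq b v (n + 1) = v n := rfl

theorem exists_eq_consSeq (w : ℕ → Bool) : ∃ b v, w = consSeq b v :=
  ⟨w 0, fun n => w (n + 1), by ext (_ | n) <;> rfl⟩

theorem a1_consSeq (b : Bool) (v : ℕ → Bool) : a1 (consSeq b v) = consSeq (!b) v := by
  ext (_ | n) <;> simp [a1, consSeq]

theorem a2_consSeq_true (v : ℕ → Bool) : a2 (consSeq true v) = consSeq true (a2 v) := by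
  ext (_ | _ | n)
  · simp [a2, consSeq]
  · simp [a2, consSeq]
  · have h : (∀ j < n + 1, consSeq true v j = true) ↔ ∀ j < n, v j = true := by
      simp only [Nat.forall_lt_succ_left', consSeq_zero, consSeq_succ, true_and]
    simp only [a2, consSeq_succ, Nat.add_sub_cancel, h]
    simp

theorem a2_consSeq_false (v : ℕ → Bool) : a2 (consSeq false v) = consSeq false (a1 v) := by
  ext (_ | _ | n)
  · simp [a2, consSeq]
  · simp [a2, a1, consSeq]
  · have h : ¬ ∀ j < n + 1, consSeq false v j = true := fun h => by
      simpa [consSeq] using h 0 (Nat.succ_pos n)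
    simp only [a2, a1, consSeq_succ, Nat.add_sub_cancel, h]
    simp

theorem a1_a1 (w : ℕ → Bool) : a1 (a1 w) = w := by
  obtain ⟨b, v, rfl⟩ := exists_eq_consSeq w
  simp [a1_consSeq]

theorem a2_a2 (w : ℕ → Bool) : a2 (a2 w) = w := by
  ext i
  induction i generalizing w with
  | zero => simp [a2]
  | succ i ih =>
    obtain ⟨_ | _, v, rfl⟩ := exists_eq_consSeq w
    · simp [a2_consSeq_false, a1_a1]
    · simpa [a2_consSeq_true, consSeq] using ih v

theorem prefixPreserving_a1 : PrefixPreserving a1 := by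
  intro n v w h i hi
  have h0 := h 0 (by omega)
  simp [a1, h0, h i hi]

theorem prefixPreserving_a2 : PrefixPreserving a2 := by
  intro n v w h i hi
  have h1 : (∀ j < i - 1, v j = true) ↔ ∀ j < i - 1, w j = true :=
    forall₂_congr fun j hj => by rw [h j (by omega)]
  simp only [a2, h1, h i hi, h (i - 1) (by omega)]

theorem PrefixPreserving.comp {f g : (ℕ → Bool) → (ℕ → Bool)} (hf : PrefixPreserving f)
    (hg : PrefixPreserving g) : PrefixPreserving (f ∘ g) :=
  fun n v w h => hf n _ _ (hg n v w h)

/-- Extension of a finite word by `0^∞`. -/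
def padSeq {n : ℕ} (u : Fin n → Bool) : ℕ → Bool :=
  fun i => if h : i < n then u ⟨i, h⟩ else false

theorem padSeq_fin {n : ℕ} (u : Fin n → Bool) (i : Fin n) : padSeq u i = u i := by
  simp [padSeq]

theorem padSeq_restrict {n : ℕ} (w : ℕ → Bool) {i : ℕ} (hi : i < n) :
    padSeq (fun j : Fin n => w j) i = w i := by
  simp [padSeq, hi]

theorem PrefixPreserving.exists_inducesPerm {f g : (ℕ → Bool) → (ℕ → Bool)}
    (hf : PrefixPreserving f) (hg : PrefixPreserving g) (hgf : LeftInverse g f)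
    (hfg : LeftInverse f g) (n : ℕ) : ∃ G : Equiv.Perm (Fin n → Bool), InducesPerm f n G := by
  refine ⟨⟨fun u i => f (padSeq u) i, fun u i => g (padSeq u) i, fun u => ?_, fun u => ?_⟩,
    fun w i => (hf n _ _ (fun j hj => padSeq_restrict w hj) i i.2).symm⟩
  · ext i
    change g (padSeq fun j : Fin n => f (padSeq u) j) i = u i
    rw [hg n _ _ (fun j hj => padSeq_restrict (f (padSeq u)) hj) i i.2, hgf, padSeq_fin]
  · ext i
    change f (padSeq fun j : Fin n => g (padSeq u) j) i = u i
    rw [hf n _ _ (fun j hj => padSeq_restrict (g (padSeq u)) hj) i i.2, hfg, padSeq_fin]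

theorem InducesPerm.iterate_restrict {f : (ℕ → Bool) → (ℕ → Bool)} {n : ℕ}
    {G : Equiv.Perm (Fin n → Bool)} (h : InducesPerm f n G) (k : ℕ) (w : ℕ → Bool) :
    G^[k] (fun i : Fin n => w i) = fun i : Fin n => f^[k] w i := by
  have hs : Semiconj (fun (w : ℕ → Bool) (i : Fin n) => w i) f G := fun w => funext (h w)
  exact ((hs.iterate_right k) w).symm

theorem iterate_two_mul_consSeq {f g : (ℕ → Bool) → (ℕ → Bool)} {b : Bool}
    (h : ∀ v, f (f (consSeq b v)) = consSeq b (g v)) (k : ℕ) (v : ℕ → Bool) :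
    f^[2 * k] (consSeq b v) = consSeq b (g^[k] v) := by
  have hs : Semiconj (consSeq b) g f^[2] := fun v => (h v).symm
  rw [iterate_mul]
  exact ((hs.iterate_right k) v).symm

theorem a1_a2_sq_consSeq_false (v : ℕ → Bool) :
    (a1 ∘ a2) ((a1 ∘ a2) (consSeq false v)) = consSeq false ((a2 ∘ a1) v) := by
  simp [a1_consSeq, a2_consSeq_false, a2_consSeq_true]

theorem a1_a2_sq_consSeq_true (v : ℕ → Bool) :
    (a1 ∘ a2) ((a1 ∘ a2) (consSeq true v)) = consSeq true ((a1 ∘ a2) v) := by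
  simp [a1_consSeq, a2_consSeq_false, a2_consSeq_true]

theorem a2_a1_sq_consSeq_false (v : ℕ → Bool) :
    (a2 ∘ a1) ((a2 ∘ a1) (consSeq false v)) = consSeq false ((a1 ∘ a2) v) := by
  simp [a1_consSeq, a2_consSeq_false, a2_consSeq_true]

theorem a2_a1_sq_consSeq_true (v : ℕ → Bool) :
    (a2 ∘ a1) ((a2 ∘ a1) (consSeq true v)) = consSeq true ((a2 ∘ a1) v) := by
  simp [a1_consSeq, a2_consSeq_false, a2_consSeq_true]

theorem a1_a2_apply_zero (w : ℕ → Bool) : (a1 ∘ a2) w 0 = !(w 0) := by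
  simp [a1, a2]

theorem a2_a1_apply_zero (w : ℕ → Bool) : (a2 ∘ a1) w 0 = !(w 0) := by
  simp [a1, a2]

/-- Every length-`n` prefix occurs along every forward orbit of `f`. -/
def PrefixTransitive (f : (ℕ → Bool) → (ℕ → Bool)) (n : ℕ) : Prop :=
  ∀ w u : ℕ → Bool, ∃ k : ℕ, ∀ i < n, f^[k] w i = u i

theorem PrefixTransitive.succ {f : (ℕ → Bool) → (ℕ → Bool)} {g : Bool → (ℕ → Bool) → (ℕ → Bool)}
    {n : ℕ} (hflip : ∀ w, f w 0 = !(w 0))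
    (hsq : ∀ b v, f (f (consSeq b v)) = consSeq b (g b v))
    (hg : ∀ b, PrefixTransitive (g b) n) : PrefixTransitive f (n + 1) := by
  have key : ∀ w u : ℕ → Bool, w 0 = u 0 → ∃ k : ℕ, ∀ i < n + 1, f^[k] w i = u i := by
    intro w u h0
    obtain ⟨b, v, rfl⟩ := exists_eq_consSeq w
    obtain ⟨c, x, rfl⟩ := exists_eq_consSeq u
    obtain rfl : b = c := h0
    obtain ⟨k, hk⟩ := hg b v x
    refine ⟨2 * k, fun i hi => ?_⟩
    rw [iterate_two_mul_consSeq (hsq b)]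
    cases i with
    | zero => rfl
    | succ i => exact hk i (by omega)
  intro w u
  by_cases h0 : w 0 = u 0
  · exact key w u h0
  · obtain ⟨k, hk⟩ := key (f w) u (by rw [hflip, Bool.not_eq]; exact h0)
    exact ⟨k + 1, hk⟩

theorem prefixTransitive_a1_a2 (n : ℕ) :
    PrefixTransitive (a1 ∘ a2) n ∧ PrefixTransitive (a2 ∘ a1) n := by
  induction n with
  | zero => exact ⟨fun _ _ => ⟨0, by simp⟩, fun _ _ => ⟨0, by simp⟩⟩
  | succ n ih =>
    constructor
    · exact .succ (g := fun b => bif b then a1 ∘ a2 else a2 ∘ a1) a1_a2_apply_zero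
        (by rintro (_ | _) v; exacts [a1_a2_sq_consSeq_false v, a1_a2_sq_consSeq_true v])
        (by rintro (_ | _); exacts [ih.2, ih.1])
    · exact .succ (g := fun b => bif b then a2 ∘ a1 else a1 ∘ a2) a2_a1_apply_zero
        (by rintro (_ | _) v; exacts [a2_a1_sq_consSeq_false v, a2_a1_sq_consSeq_true v])
        (by rintro (_ | _); exacts [ih.1, ih.2])

theorem a1_a2_iterate_ne_id (k : ℕ) (hk : 1 ≤ k) : (a1 ∘ a2)^[k] ≠ id := by
  induction k using Nat.strong_induction_on with
  | _ k ih =>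
    intro h
    obtain ⟨m, rfl | rfl⟩ := Nat.even_or_odd' k
    · refine ih m (by omega) (by omega) (funext fun v => funext fun i => ?_)
      have h1 := iterate_two_mul_consSeq a1_a2_sq_consSeq_true m v
      rw [h] at h1
      exact (congrFun h1 (i + 1)).symm
    · have h1 := congrFun (congrFun h (consSeq true fun _ => true)) 0
      rw [iterate_succ_apply', iterate_two_mul_consSeq a1_a2_sq_consSeq_true,
        a1_a2_apply_zero] at h1
      simp [consSeq] at h1

theorem dense_of_forall_prefixTransitive {f : (ℕ → Bool) → (ℕ → Bool)}
    (hf : ∀ n, PrefixTransitive f n) (w : ℕ → Bool) : Dense {y | ∃ k : ℕ, f^[k] w = y} := by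
  intro y
  choose k hk using fun n => hf n w y
  refine mem_closure_of_tendsto (f := fun n => f^[k n] w) (b := Filter.atTop) ?_
    (Filter.Eventually.of_forall fun n => ⟨k n, rfl⟩)
  refine tendsto_pi_nhds.2 fun i => tendsto_nhds_of_eventually_eq ?_
  filter_upwards [Filter.eventually_gt_atTop i] with n hn using hk n i hn

/-- for `h = a₁ ∘ a₂`: (a) for every `n ≥ 1`, `h` induces a permutation of
length-`n` prefixes which is a single cycle of length `2^n`; hence `h` has infinite order
and every `⟨h⟩`-orbit in `{0,1}^ℕ` is dense. (b) `(h ∘ a₁)²` is the identity. -/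
theorem stmt18 :
    (∀ n : ℕ, 1 ≤ n → ∃ G : Equiv.Perm (Fin n → Bool),
      InducesPerm (a1 ∘ a2) n G ∧
      ∀ u u' : Fin n → Bool, ∃ k : ℕ, (⇑G)^[k] u = u') ∧
    (∀ k : ℕ, 1 ≤ k → (a1 ∘ a2)^[k] ≠ id) ∧
    (∀ w : ℕ → Bool,
      Dense {y | ∃ k : ℕ, (a1 ∘ a2)^[k] w = y ∨ (a1 ∘ a2)^[k] y = w}) ∧
    ((a1 ∘ a2) ∘ a1) ∘ ((a1 ∘ a2) ∘ a1) = id := by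
  refine ⟨fun n _ => ?_, a1_a2_iterate_ne_id, fun w => ?_, ?_⟩
  · obtain ⟨G, hG⟩ := (prefixPreserving_a1.comp prefixPreserving_a2).exists_inducesPerm
      (prefixPreserving_a2.comp prefixPreserving_a1)
      (fun w => by simp [a1_a1, a2_a2]) (fun w => by simp [a1_a1, a2_a2]) n
    refine ⟨G, hG, fun u u' => ?_⟩
    obtain ⟨k, hk⟩ := (prefixTransitive_a1_a2 n).1 (padSeq u) (padSeq u')
    refine ⟨k, ?_⟩
    have h := hG.iterate_restrict k (padSeq u)
    simp only [padSeq_fin] at h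
    rw [h]
    ext i
    rw [hk i i.2, padSeq_fin]
  · exact (dense_of_forall_prefixTransitive (fun n => (prefixTransitive_a1_a2 n).1) w).mono
      fun _ hy => hy.imp fun _ hk => .inl hk
  · ext w
    simp [a1_a1, a2_a2]
end
end
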